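/- arXiv:math/0503346 — 9 statements merged into one kernel-verified Lean document; each statement's English description precedes it below -/
import Mathlib

section
/- Let G⁰, G¹, G² be finite-dimensional complex vector spaces with dim G² ≥ 1, dim G⁰ > 1 and dim G¹ = p·dim G⁰ for some positive integer p. Then for every integer k with 3p ≤ k ≤ dim G⁰ · dim G¹ there exists a k-dimensional subspace E ⊆ Hom(G⁰,G¹) such that Symm(φ_E) = {0}. -/
/-- For a subspace `E ⊆ Hom(G⁰, G¹)`, the symmetrizer space of the bilinear map
`φ_E : E × Hom(G¹, G²) → Hom(G⁰, G²)`, `(α, β) ↦ β ∘ α`: it consists of the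
linear maps `q : E → Hom(G¹, G²)` such that `q α' ∘ α = q α ∘ α'` for all
`α, α' ∈ E`. -/
def Symm {G0 G1 G2 : Type*}
    [AddCommGroup G0] [Module ℂ G0] [AddCommGroup G1] [Module ℂ G1]
    [AddCommGroup G2] [Module ℂ G2]
    (E : Submodule ℂ (G0 →ₗ[ℂ] G1)) : Set (E →ₗ[ℂ] (G1 →ₗ[ℂ] G2)) :=
  {q | ∀ α α' : E, (q α') ∘ₗ (α : G0 →ₗ[ℂ] G1) = (q α) ∘ₗ (α' : G0 →ₗ[ℂ] G1)}

/-- There are two endomorphisms whose commutator is surjective (stated by testing on linear maps). -/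
theorem exists_comm_pair (V W : Type*) [AddCommGroup V] [Module ℂ V] [FiniteDimensional ℂ V]
    [AddCommGroup W] [Module ℂ W] (hV : 1 < Module.finrank ℂ V) :
    ∃ A B : V →ₗ[ℂ] V, ∀ r : V →ₗ[ℂ] W, (r ∘ₗ A) ∘ₗ B = (r ∘ₗ B) ∘ₗ A → r = 0 := by
  obtain ⟨m, hm⟩ : ∃ m, Module.finrank ℂ V = m + 2 := ⟨Module.finrank ℂ V - 2, by omega⟩
  let b : Module.Basis (Fin (m + 2)) ℂ V := Module.finBasisOfFinrankEq ℂ V hm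
  refine ⟨b.constr ℂ (fun i => ((i : ℕ) : ℂ) • b i), b.constr ℂ (fun i => b (i + 1)), ?_⟩
  intro r hr
  apply b.ext
  intro j
  have h := LinearMap.congr_fun hr (b (j - 1))
  simp only [LinearMap.comp_apply, Module.Basis.constr_basis, map_smul, sub_add_cancel] at h
  have hne : ((j : ℕ) : ℂ) ≠ (((j - 1 : Fin (m + 2)) : ℕ) : ℂ) := by
    intro hh
    have h2 : j = j - 1 := Fin.ext (Nat.cast_injective hh)
    have h3 : (1 : Fin (m + 2)) = 0 := by
      have := sub_eq_self.mp h2.symm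
      exact this
    exact one_ne_zero h3
  have h4 : (((j : ℕ) : ℂ) - (((j - 1 : Fin (m + 2)) : ℕ) : ℂ)) • r (b j) = 0 := by
    rw [sub_smul, h, sub_self]
  rcases smul_eq_zero.mp h4 with h5 | h5
  · exact absurd (sub_eq_zero.mp h5) hne
  · simpa using h5

/-- Enlarging a subspace to a prescribed dimension. -/
theorem exists_ge_finrank_eq {V : Type*} [AddCommGroup V] [Module ℂ V] [FiniteDimensional ℂ V]
    (S : Submodule ℂ V) (k : ℕ) (h1 : Module.finrank ℂ S ≤ k) (h2 : k ≤ Module.finrank ℂ V) :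
    ∃ E : Submodule ℂ V, S ≤ E ∧ Module.finrank ℂ E = k := by
  induction k, h1 using Nat.le_induction with
  | base => exact ⟨S, le_rfl, rfl⟩
  | succ k hk ih =>
    obtain ⟨E, hSE, hE⟩ := ih (by omega)
    have hlt : E < ⊤ := by
      rw [lt_top_iff_ne_top]
      rintro rfl
      rw [finrank_top] at hE
      omega
    obtain ⟨x, -, hx⟩ := SetLike.exists_of_lt hlt
    have hEF : E < E ⊔ Submodule.span ℂ {x} := by
      refine lt_of_le_of_ne le_sup_left fun h => hx ?_
      rw [h]
      exact Submodule.mem_sup_right (Submodule.mem_span_singleton_self x)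
    refine ⟨E ⊔ Submodule.span ℂ {x}, hSE.trans hEF.le, ?_⟩
    have h3 := Submodule.finrank_lt_finrank_of_lt hEF
    have h4 := Submodule.finrank_add_le_finrank_add_finrank E (Submodule.span ℂ {x})
    have h5 : Module.finrank ℂ (Submodule.span ℂ {x}) ≤ 1 := by
      simpa using finrank_span_le_card (R := ℂ) ({x} : Set V)
    omega

/-- Let `G⁰, G¹, G²` be finite-dimensional complex vector spaces with
`dim G² ≥ 1`, `dim G⁰ > 1` and `dim G¹ = p · dim G⁰` for some positive
integer `p`.  Then for every integer `k` with `3p ≤ k ≤ dim G⁰ · dim G¹` there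
is a `k`-dimensional subspace `E ⊆ Hom(G⁰, G¹)` with `Symm(φ_E) = {0}`. -/
theorem stmt1 (G0 G1 G2 : Type*)
    [AddCommGroup G0] [Module ℂ G0] [FiniteDimensional ℂ G0]
    [AddCommGroup G1] [Module ℂ G1] [FiniteDimensional ℂ G1]
    [AddCommGroup G2] [Module ℂ G2] [FiniteDimensional ℂ G2]
    (hG2 : 1 ≤ Module.finrank ℂ G2) (hG0 : 1 < Module.finrank ℂ G0)
    (p : ℕ) (hp : 0 < p)
    (hG1 : Module.finrank ℂ G1 = p * Module.finrank ℂ G0)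
    (k : ℕ) (hk₁ : 3 * p ≤ k)
    (hk₂ : k ≤ Module.finrank ℂ G0 * Module.finrank ℂ G1) :
    ∃ E : Submodule ℂ (G0 →ₗ[ℂ] G1), Module.finrank ℂ E = k ∧
      Symm (G2 := G2) E = {0} := by
  classical
  obtain ⟨A, B, hAB⟩ := exists_comm_pair G0 G2 hG0
  have e : (Fin p → G0) ≃ₗ[ℂ] G1 := LinearEquiv.ofFinrankEq _ _ (by
    rw [Module.finrank_pi_fintype, hG1]; simp)
  let ι : Fin p → (G0 →ₗ[ℂ] G1) := fun i => e.toLinearMap ∘ₗ LinearMap.single ℂ (fun _ => G0) i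
  have hι : ∀ f : G1 →ₗ[ℂ] G2, (∀ i, f ∘ₗ ι i = 0) → f = 0 := by
    intro f hf
    have h1 : f ∘ₗ e.toLinearMap = 0 := by
      apply LinearMap.pi_ext'
      intro i
      rw [LinearMap.zero_comp, LinearMap.comp_assoc]
      exact hf i
    ext x
    have := LinearMap.congr_fun h1 (e.symm x)
    simpa using this
  let M : Fin 3 → (G0 →ₗ[ℂ] G0) := ![LinearMap.id, A, B]
  let g : Fin p × Fin 3 → (G0 →ₗ[ℂ] G1) := fun x => ι x.1 ∘ₗ M x.2
  have hS : Module.finrank ℂ (Submodule.span ℂ (Set.range g)) ≤ k := by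
    have := finrank_range_le_card (R := ℂ) g
    simp only [Fintype.card_prod, Fintype.card_fin] at this
    unfold Set.finrank at this
    omega
  obtain ⟨E, hSE, hE⟩ := exists_ge_finrank_eq _ k hS (by
    rw [Module.finrank_linearMap]; exact hk₂)
  refine ⟨E, hE, ?_⟩
  have hgE : ∀ x, g x ∈ E := fun x => hSE (Submodule.subset_span ⟨x, rfl⟩)
  have hιE : ∀ i, ι i ∈ E := fun i => hgE (i, 0)
  have hAE : ∀ i, ι i ∘ₗ A ∈ E := fun i => hgE (i, 1)
  have hBE : ∀ i, ι i ∘ₗ B ∈ E := fun i => hgE (i, 2)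
  apply Set.eq_singleton_iff_unique_mem.mpr
  constructor
  · intro α α'
    simp
  intro q hq
  have hq' : ∀ α α' : E, (q α') ∘ₗ (α : G0 →ₗ[ℂ] G1) = (q α) ∘ₗ (α' : G0 →ₗ[ℂ] G1) := hq
  have hzero : ∀ i, q ⟨ι i, hιE i⟩ = 0 := by
    intro i
    apply hι
    intro j
    apply hAB
    have e1 := hq' ⟨ι j, hιE j⟩ ⟨ι i, hιE i⟩
    have e2 := hq' ⟨ι j, hιE j⟩ ⟨ι i ∘ₗ A, hAE i⟩
    have e3 := hq' ⟨ι j ∘ₗ B, hBE j⟩ ⟨ι i, hιE i⟩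
    have e4 := hq' ⟨ι j ∘ₗ B, hBE j⟩ ⟨ι i ∘ₗ A, hAE i⟩
    simp only [← LinearMap.comp_assoc] at e1 e2 e3 e4
    rw [e1, ← e2, e4, ← e3, e1]
  ext1 α
  apply hι
  intro j
  have := hq' ⟨ι j, hιE j⟩ α
  rw [hzero j] at this
  simpa using this
end

section
/- Let G⁰, G¹, G² be finite-dimensional complex vector spaces with dim G² ≥ 1 and dim G⁰ > dim G¹ = 1. Then for every integer k with 2 ≤ k ≤ dim G⁰ · dim G¹ there exists a k-dimensional subspace E ⊆ Hom(G⁰,G¹) such that Symm(φ_E) = {0}. -/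
/-- Let `G⁰, G¹, G²` be finite-dimensional complex vector spaces with
`dim G² ≥ 1` and `dim G⁰ > dim G¹ = 1`.  Then for every integer `k` with
`2 ≤ k ≤ dim G⁰ · dim G¹` there is a `k`-dimensional subspace
`E ⊆ Hom(G⁰, G¹)` with `Symm(φ_E) = {0}`. -/
theorem stmt2 (G0 G1 G2 : Type*)
    [AddCommGroup G0] [Module ℂ G0] [FiniteDimensional ℂ G0]
    [AddCommGroup G1] [Module ℂ G1] [FiniteDimensional ℂ G1]
    [AddCommGroup G2] [Module ℂ G2] [FiniteDimensional ℂ G2]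
    (hG2 : 1 ≤ Module.finrank ℂ G2)
    (hG0 : Module.finrank ℂ G1 < Module.finrank ℂ G0)
    (hG1 : Module.finrank ℂ G1 = 1)
    (k : ℕ) (hk₁ : 2 ≤ k)
    (hk₂ : k ≤ Module.finrank ℂ G0 * Module.finrank ℂ G1) :
    ∃ E : Submodule ℂ (G0 →ₗ[ℂ] G1), Module.finrank ℂ E = k ∧
      Symm (G2 := G2) E = {0} := by
  have hfr : Module.finrank ℂ (G0 →ₗ[ℂ] G1) = Module.finrank ℂ G0 * Module.finrank ℂ G1 :=
    Module.finrank_linearMap ℂ ℂ G0 G1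
  obtain ⟨v, hv⟩ := exists_linearIndependent_of_le_finrank (R := ℂ) (hk₂.trans hfr.ge)
  refine ⟨Submodule.span ℂ (Set.range v), ?_, ?_⟩
  · rw [finrank_span_eq_card hv, Fintype.card_fin]
  have hE : Module.finrank ℂ (Submodule.span ℂ (Set.range v)) = k := by
    rw [finrank_span_eq_card hv, Fintype.card_fin]
  generalize Submodule.span ℂ (Set.range v) = E at hE
  ext q
  simp only [Symm, Set.mem_setOf_eq, Set.mem_singleton_iff]
  constructor
  swap
  · rintro rfl α α'
    simp
  intro hq
  ext1 α
  by_cases hα : α = 0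
  · simp [hα]
  obtain ⟨α', hα'⟩ : ∃ α' : E, ∀ d : ℂ, d • α ≠ α' := by
    by_contra! h
    have := finrank_le_one α h
    omega
  obtain ⟨x, hx, hx'⟩ : ∃ x, (α : G0 →ₗ[ℂ] G1) x = 0 ∧ (α' : G0 →ₗ[ℂ] G1) x ≠ 0 := by
    by_contra! h
    obtain ⟨x0, hx0⟩ : ∃ x0, (α : G0 →ₗ[ℂ] G1) x0 ≠ 0 := by
      by_contra! h0
      exact hα (Subtype.ext (LinearMap.ext h0))
    obtain ⟨d, hd⟩ := exists_smul_eq_of_finrank_eq_one hG1 hx0 ((α' : G0 →ₗ[ℂ] G1) x0)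
    apply hα' d
    apply Subtype.ext
    apply LinearMap.ext
    intro y
    obtain ⟨c, hc⟩ := exists_smul_eq_of_finrank_eq_one hG1 hx0 ((α : G0 →ₗ[ℂ] G1) y)
    have h1 := h (y - c • x0) (by simp [hc])
    rw [map_sub, map_smul, sub_eq_zero] at h1
    rw [h1, ← hd, Submodule.coe_smul, LinearMap.smul_apply, ← hc, smul_comm]
  apply LinearMap.ext
  intro y
  obtain ⟨c, rfl⟩ := exists_smul_eq_of_finrank_eq_one hG1 hx' y
  have h2 := LinearMap.congr_fun (hq α α') x
  simp only [LinearMap.comp_apply, hx, map_zero] at h2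
  simp [← h2]
end

section
/- Let G⁰, G¹, G² be finite-dimensional complex vector spaces with dim G² ≥ 1 and dim G⁰ > dim G¹ > 1. Then for every integer k with 3 ≤ k ≤ dim G⁰ · dim G¹ there exists a k-dimensional subspace E ⊆ Hom(G⁰,G¹) such that Symm(φ_E) = {0}. -/
theorem symm_aux_extend {V : Type*} [AddCommGroup V] [Module ℂ V] [FiniteDimensional ℂ V]
    (W : Submodule ℂ V) (k : ℕ) (h1 : Module.finrank ℂ W ≤ k) (h2 : k ≤ Module.finrank ℂ V) :
    ∃ E : Submodule ℂ V, W ≤ E ∧ Module.finrank ℂ E = k := by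
  induction k, h1 using Nat.le_induction with
  | base => exact ⟨W, le_rfl, rfl⟩
  | succ n hn ih =>
    obtain ⟨E, hWE, hE⟩ := ih (by omega)
    have hne : E ≠ ⊤ := by
      rintro rfl
      rw [finrank_top] at hE
      omega
    obtain ⟨v, hv⟩ : ∃ v, v ∉ E := by
      by_contra! h
      exact hne (Submodule.eq_top_iff'.2 h)
    have hv0 : v ≠ 0 := fun h => hv (h ▸ E.zero_mem)
    refine ⟨E ⊔ Submodule.span ℂ {v}, hWE.trans le_sup_left, ?_⟩
    have h := Submodule.finrank_sup_add_finrank_inf_eq E (Submodule.span ℂ {v})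
    have hd : E ⊓ Submodule.span ℂ {v} = ⊥ :=
      disjoint_iff.1 ((Submodule.disjoint_span_singleton' hv0).2 hv)
    rw [hd, finrank_bot, finrank_span_singleton hv0, hE] at h
    omega

/-- Let `G⁰, G¹, G²` be finite-dimensional complex vector spaces with
`dim G² ≥ 1` and `dim G⁰ > dim G¹ > 1`.  Then for every integer `k` with
`3 ≤ k ≤ dim G⁰ · dim G¹` there is a `k`-dimensional subspace
`E ⊆ Hom(G⁰, G¹)` with `Symm(φ_E) = {0}`. -/
theorem stmt3 (G0 G1 G2 : Type*)
    [AddCommGroup G0] [Module ℂ G0] [FiniteDimensional ℂ G0]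
    [AddCommGroup G1] [Module ℂ G1] [FiniteDimensional ℂ G1]
    [AddCommGroup G2] [Module ℂ G2] [FiniteDimensional ℂ G2]
    (hG2 : 1 ≤ Module.finrank ℂ G2)
    (hG0 : Module.finrank ℂ G1 < Module.finrank ℂ G0)
    (hG1 : 1 < Module.finrank ℂ G1)
    (k : ℕ) (hk₁ : 3 ≤ k)
    (hk₂ : k ≤ Module.finrank ℂ G0 * Module.finrank ℂ G1) :
    ∃ E : Submodule ℂ (G0 →ₗ[ℂ] G1), Module.finrank ℂ E = k ∧
      Symm (G2 := G2) E = {0} := by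
  classical
  set a := Module.finrank ℂ G0 with ha
  set b := Module.finrank ℂ G1 with hb
  let e := Module.finBasis ℂ G0
  let f := Module.finBasis ℂ G1
  let F : ℕ → G1 := fun j => if h : j < b then f ⟨j, h⟩ else 0
  have hF : ∀ j, b ≤ j → F j = 0 := fun j hj => dif_neg (by omega)
  have hFf : ∀ i : Fin b, F i = f i := fun i => dif_pos i.2
  let A1 : G0 →ₗ[ℂ] G1 := e.constr ℂ (fun j => F j)
  let A2 : G0 →ₗ[ℂ] G1 := e.constr ℂ (fun j => if (j : ℕ) = 0 then 0 else F (j - 1))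
  let A3 : G0 →ₗ[ℂ] G1 := e.constr ℂ (fun j => ((j : ℕ) : ℂ) • F j)
  have hA1 : ∀ (j : ℕ) (hj : j < a), A1 (e ⟨j, hj⟩) = F j := fun j hj => by
    simp only [A1, Module.Basis.constr_basis]
  have hA2 : ∀ (j : ℕ) (hj : j < a), A2 (e ⟨j, hj⟩) = if j = 0 then 0 else F (j - 1) :=
    fun j hj => by simp only [A2, Module.Basis.constr_basis]
  have hA3 : ∀ (j : ℕ) (hj : j < a), A3 (e ⟨j, hj⟩) = (j : ℂ) • F j := fun j hj => by
    simp only [A3, Module.Basis.constr_basis]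
  -- a linear map out of `G1` vanishing on all `F j` with `j < b` is zero
  have hzero : ∀ r : G1 →ₗ[ℂ] G2, (∀ j, j < b → r (F j) = 0) → r = 0 := fun r hr =>
    f.ext fun i => by
      have := hr i i.2
      rw [hFf] at this
      simpa using this
  let S : Finset (G0 →ₗ[ℂ] G1) := {A1, A2, A3}
  have hS : Module.finrank ℂ (Submodule.span ℂ (S : Set (G0 →ₗ[ℂ] G1))) ≤ k :=
    ((finrank_span_finset_le_card S).trans Finset.card_le_three).trans hk₁
  obtain ⟨E, hSE, hE⟩ := symm_aux_extend (Submodule.span ℂ (S : Set (G0 →ₗ[ℂ] G1))) k hS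
    (by rw [Module.finrank_linearMap]; exact hk₂)
  refine ⟨E, hE, ?_⟩
  have m1 : A1 ∈ E := hSE (Submodule.subset_span (by simp [S]))
  have m2 : A2 ∈ E := hSE (Submodule.subset_span (by simp [S]))
  have m3 : A3 ∈ E := hSE (Submodule.subset_span (by simp [S]))
  ext q
  simp only [Set.mem_singleton_iff]
  constructor
  swap
  · rintro rfl α α'
    simp
  intro hq
  have hq' : ∀ (α α' : E) (x : G0), q α' ((α : G0 →ₗ[ℂ] G1) x) = q α ((α' : G0 →ₗ[ℂ] G1) x) :=
    fun α α' x => LinearMap.congr_fun (hq α α') x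
  have h12 : ∀ j, j < a → q ⟨A2, m2⟩ (F j) = q ⟨A1, m1⟩ (if j = 0 then 0 else F (j - 1)) :=
    fun j hj => by
      have := hq' ⟨A1, m1⟩ ⟨A2, m2⟩ (e ⟨j, hj⟩)
      simpa only [hA1, hA2] using this
  have h13 : ∀ j, j < a → q ⟨A3, m3⟩ (F j) = (j : ℂ) • q ⟨A1, m1⟩ (F j) :=
    fun j hj => by
      have := hq' ⟨A1, m1⟩ ⟨A3, m3⟩ (e ⟨j, hj⟩)
      simpa only [hA1, hA3, map_smul] using this
  have h23 : ∀ j, j < a →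
      q ⟨A3, m3⟩ (if j = 0 then 0 else F (j - 1)) = (j : ℂ) • q ⟨A2, m2⟩ (F j) :=
    fun j hj => by
      have := hq' ⟨A2, m2⟩ ⟨A3, m3⟩ (e ⟨j, hj⟩)
      simpa only [hA2, hA3, map_smul] using this
  have hQ1 : q ⟨A1, m1⟩ = 0 := by
    apply hzero
    intro j hj
    have e12 := h12 (j + 1) (by omega)
    have e13 := h13 j (by omega)
    have e23 := h23 (j + 1) (by omega)
    simp only [Nat.add_eq_zero_iff, one_ne_zero, and_false, if_false, Nat.add_sub_cancel]
      at e12 e23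
    rw [e12, e13] at e23
    have : ((j + 1 : ℕ) : ℂ) • q ⟨A1, m1⟩ (F j) - (j : ℂ) • q ⟨A1, m1⟩ (F j) = 0 :=
      sub_eq_zero.2 e23.symm
    rw [← sub_smul] at this
    simpa using this
  apply LinearMap.ext
  intro α
  apply hzero
  intro j hj
  have := hq' ⟨A1, m1⟩ α (e ⟨j, by omega⟩)
  simpa only [hA1, hQ1, LinearMap.zero_apply] using this
end

section
/- Let G⁰, G¹, G² be finite-dimensional complex vector spaces with dim G² ≥ 1, dim G⁰ > 1 and dim G¹ ≥ 1, and set p = ⌊(dim G¹ − 1)/dim G⁰⌋ + 1. Then for every integer k with 3p ≤ k ≤ dim G⁰ · dim G¹ there exists a k-dimensional subspace E ⊆ Hom(G⁰,G¹) such that Symm(φ_E) = {0}. -/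
theorem exists_extension {V : Type*} [AddCommGroup V] [Module ℂ V] [FiniteDimensional ℂ V]
    (W : Submodule ℂ V) (d : ℕ) (hd : Module.finrank ℂ W + d ≤ Module.finrank ℂ V) :
    ∃ E : Submodule ℂ V, W ≤ E ∧ Module.finrank ℂ E = Module.finrank ℂ W + d := by
  induction d with
  | zero => exact ⟨W, le_rfl, rfl⟩
  | succ d ih =>
    obtain ⟨E, hWE, hE⟩ := ih (by omega)
    have hne : E ≠ ⊤ := by
      rintro rfl
      rw [finrank_top] at hE
      omega
    obtain ⟨x, hx⟩ : ∃ x, x ∉ E := by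
      by_contra! h
      exact hne (Submodule.eq_top_iff'.2 h)
    have hlt : E < Submodule.span ℂ {x} ⊔ E := (Submodule.covBy_span_singleton_sup hx).1
    refine ⟨_, hWE.trans hlt.le, ?_⟩
    have h1 := Submodule.finrank_lt_finrank_of_lt hlt
    have h2 := Submodule.finrank_add_le_finrank_add_finrank (Submodule.span ℂ {x}) E
    have h3 : Module.finrank ℂ (Submodule.span ℂ {x}) ≤ 1 := by
      simpa using finrank_span_le_card (R := ℂ) ({x} : Set V)
    omega

theorem exists_commutator_surj {G0 : Type*} [AddCommGroup G0] [Module ℂ G0] [FiniteDimensional ℂ G0]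
    (hG0 : 1 < Module.finrank ℂ G0) :
    ∃ A B : G0 →ₗ[ℂ] G0, ∀ v : G0, ∃ w, A (B w) - B (A w) = v := by
  obtain ⟨l, hl⟩ : ∃ l, Module.finrank ℂ G0 = l + 2 := ⟨_, (Nat.sub_add_cancel hG0).symm⟩
  let b : Module.Basis (Fin (l + 2)) ℂ G0 := Module.finBasisOfFinrankEq ℂ G0 hl
  let A : G0 →ₗ[ℂ] G0 := b.constr ℂ (fun i => ((i : ℕ) : ℂ) • b i)
  let B : G0 →ₗ[ℂ] G0 := b.constr ℂ (fun i => b (i + 1))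
  have hA : ∀ i, A (b i) = ((i : ℕ) : ℂ) • b i := fun i => by simp [A]
  have hB : ∀ i, B (b i) = b (i + 1) := fun i => by simp [B]
  refine ⟨A, B, ?_⟩
  have key : LinearMap.range (A ∘ₗ B - B ∘ₗ A) = ⊤ := by
    rw [eq_top_iff, ← b.span_eq, Submodule.span_le]
    rintro _ ⟨j, rfl⟩
    have hne : (((j : ℕ) : ℂ) - (((j - 1 : Fin (l + 2)) : ℕ) : ℂ)) ≠ 0 := by
      rw [sub_ne_zero]
      intro h
      have h' : j = j - 1 := Fin.ext (by exact_mod_cast h)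
      have h1 : (1 : Fin (l + 2)) = 0 := sub_eq_self.1 h'.symm
      exact one_ne_zero h1
    refine ⟨(((j : ℕ) : ℂ) - (((j - 1 : Fin (l + 2)) : ℕ) : ℂ))⁻¹ • b (j - 1), ?_⟩
    rw [map_smul]
    simp only [LinearMap.sub_apply, LinearMap.comp_apply, hA, hB, map_smul, sub_add_cancel]
    rw [← sub_smul, smul_smul, inv_mul_cancel₀ hne, one_smul]
  intro v
  obtain ⟨w, hw⟩ := LinearMap.range_eq_top.1 key v
  exact ⟨w, by simpa using hw⟩

theorem exists_cover {G0 G1 : Type*}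
    [AddCommGroup G0] [Module ℂ G0] [FiniteDimensional ℂ G0]
    [AddCommGroup G1] [Module ℂ G1] [FiniteDimensional ℂ G1]
    (hG0 : 1 < Module.finrank ℂ G0)
    (p : ℕ) (hp : p = (Module.finrank ℂ G1 - 1) / Module.finrank ℂ G0 + 1) :
    ∃ f : Fin p → (G0 →ₗ[ℂ] G1), (⨆ i, LinearMap.range (f i)) = ⊤ := by
  have hn : 0 < Module.finrank ℂ G0 := by omega
  let b := Module.finBasis ℂ G0
  let c := Module.finBasis ℂ G1
  refine ⟨fun i => b.constr ℂ (fun j =>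
    if h : Module.finrank ℂ G0 * (i : ℕ) + j < Module.finrank ℂ G1 then c ⟨_, h⟩ else 0), ?_⟩
  rw [eq_top_iff, ← c.span_eq, Submodule.span_le]
  rintro _ ⟨t, rfl⟩
  have ht : (t : ℕ) / Module.finrank ℂ G0 < p := by
    rw [hp]
    exact Nat.lt_succ_of_le (Nat.div_le_div_right (by have := t.2; omega))
  refine Submodule.mem_iSup_of_mem (⟨_, ht⟩ : Fin p) ?_
  refine ⟨b ⟨(t : ℕ) % Module.finrank ℂ G0, Nat.mod_lt _ hn⟩, ?_⟩
  rw [Module.Basis.constr_basis]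
  simp only [Nat.div_add_mod]
  simp

theorem ext_cover {G0 G1 G2 ι : Type*}
    [AddCommGroup G0] [Module ℂ G0] [AddCommGroup G1] [Module ℂ G1]
    [AddCommGroup G2] [Module ℂ G2] (f : ι → (G0 →ₗ[ℂ] G1))
    (hf : (⨆ i, LinearMap.range (f i)) = ⊤) (r : G1 →ₗ[ℂ] G2)
    (hr : ∀ i x, r (f i x) = 0) : r = 0 := by
  rw [← LinearMap.ker_eq_top, eq_top_iff, ← hf, iSup_le_iff]
  rintro i _ ⟨x, rfl⟩
  exact hr i x

/-- Let `G⁰, G¹, G²` be finite-dimensional complex vector spaces with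
`dim G² ≥ 1`, `dim G⁰ > 1` and `dim G¹ ≥ 1`, and set
`p = ⌊(dim G¹ − 1) / dim G⁰⌋ + 1`.  Then for every integer `k` with
`3p ≤ k ≤ dim G⁰ · dim G¹` there is a `k`-dimensional subspace
`E ⊆ Hom(G⁰, G¹)` with `Symm(φ_E) = {0}`. -/
theorem stmt5 (G0 G1 G2 : Type*)
    [AddCommGroup G0] [Module ℂ G0] [FiniteDimensional ℂ G0]
    [AddCommGroup G1] [Module ℂ G1] [FiniteDimensional ℂ G1]
    [AddCommGroup G2] [Module ℂ G2] [FiniteDimensional ℂ G2]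
    (hG2 : 1 ≤ Module.finrank ℂ G2) (hG0 : 1 < Module.finrank ℂ G0)
    (hG1 : 1 ≤ Module.finrank ℂ G1)
    (p : ℕ) (hp : p = (Module.finrank ℂ G1 - 1) / Module.finrank ℂ G0 + 1)
    (k : ℕ) (hk₁ : 3 * p ≤ k)
    (hk₂ : k ≤ Module.finrank ℂ G0 * Module.finrank ℂ G1) :
    ∃ E : Submodule ℂ (G0 →ₗ[ℂ] G1), Module.finrank ℂ E = k ∧
      Symm (G2 := G2) E = {0} := by
  obtain ⟨A, B, hAB⟩ := exists_commutator_surj hG0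
  obtain ⟨f, hf⟩ := exists_cover (G1 := G1) hG0 p hp
  let X : Fin 3 → (G0 →ₗ[ℂ] G0) := ![LinearMap.id, A, B]
  let g : Fin p × Fin 3 → (G0 →ₗ[ℂ] G1) := fun t => f t.1 ∘ₗ X t.2
  let W : Submodule ℂ (G0 →ₗ[ℂ] G1) := Submodule.span ℂ (Set.range g)
  have hW : Module.finrank ℂ W ≤ 3 * p := by
    have h := finrank_range_le_card (R := ℂ) g
    rw [Fintype.card_prod, Fintype.card_fin, Fintype.card_fin, mul_comm] at h
    exact h
  obtain ⟨E, hWE, hE⟩ := exists_extension W (k - Module.finrank ℂ W) (by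
    rw [Module.finrank_linearMap]; omega)
  refine ⟨E, by omega, ?_⟩
  have hg : ∀ t, g t ∈ E := fun t => hWE (Submodule.subset_span ⟨t, rfl⟩)
  have hf0 : ∀ i, f i ∈ E := fun i => hg (i, 0)
  have hfA : ∀ i, f i ∘ₗ A ∈ E := fun i => hg (i, 1)
  have hfB : ∀ i, f i ∘ₗ B ∈ E := fun i => hg (i, 2)
  apply Set.eq_singleton_iff_unique_mem.2
  refine ⟨fun α α' => by simp, ?_⟩
  intro q hq
  have hs : ∀ (α α' : E) (x : G0), q α' (α.1 x) = q α (α'.1 x) := fun α α' x =>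
    LinearMap.congr_fun (hq α α') x
  have h0 : ∀ i j x, q ⟨f i, hf0 i⟩ (f j x) = 0 := by
    intro i j x
    obtain ⟨w, rfl⟩ := hAB x
    have e1 := hs ⟨f i ∘ₗ A, hfA i⟩ ⟨f j ∘ₗ B, hfB j⟩ w
    have e2 := hs ⟨f i, hf0 i⟩ ⟨f j ∘ₗ B, hfB j⟩ (A w)
    have e3 := hs ⟨f j, hf0 j⟩ ⟨f i ∘ₗ A, hfA i⟩ (B w)
    have e4 := hs ⟨f i, hf0 i⟩ ⟨f j, hf0 j⟩ (A (B w))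
    simp only [LinearMap.comp_apply] at e1 e2 e3 e4
    rw [map_sub, map_sub, sub_eq_zero, ← e4, ← e3, ← e1, e2]
  have h1 : ∀ i, q ⟨f i, hf0 i⟩ = 0 := fun i => ext_cover f hf _ (h0 i)
  ext1 α
  refine ext_cover f hf _ fun i x => ?_
  have := hs ⟨f i, hf0 i⟩ α x
  simp only [h1, LinearMap.zero_apply] at this
  exact this
end

section
/- For all integers n ≥ 3 and d ≥ n+3 one has, in the integers, C(d+n+1, n+1) − (n+2)² ≥ 3·( ⌊(C(2d−1, n+1) − (n+2)·C(d, n+1) − 1) / C(d−1, n+1)⌋ + 1 ), where C(a,b) denotes the binomial coefficient and ⌊·/·⌋ denotes floor division of integers. -/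
lemma aux_T (n : ℕ) (hn : 4 ≤ n) : 6 * n * (n + 4) ≤ (2 * n + 4).choose (n + 1) := by
  induction n, hn using Nat.le_induction with
  | base => decide
  | succ n hn ih =>
    have e : 2 * (n + 1) + 4 = (2 * n + 4) + 1 + 1 := by ring
    rw [e, Nat.choose_succ_succ (2 * n + 4 + 1) (n + 1), Nat.choose_succ_succ (2 * n + 4) n,
      Nat.choose_succ_succ (2 * n + 4) (n + 1)]
    simp only [Nat.succ_eq_add_one]
    nlinarith [Nat.zero_le ((2 * n + 4).choose n), Nat.zero_le ((2 * n + 4).choose (n + 1 + 1))]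

lemma aux_base (n : ℕ) (hn : 3 ≤ n) :
    3 * ((2 * n + 5).choose (n + 1) : ℤ) ≤
      (n + 2) * (((2 * n + 4).choose (n + 1) : ℤ) - (n ^ 2 + n)) := by
  rcases Nat.eq_or_lt_of_le hn with h | h
  · subst h
    have h1 : Nat.choose 11 4 = 330 := by decide
    have h2 : Nat.choose 10 4 = 210 := by decide
    norm_num [h1, h2]
  · have hT := aux_T n h
    have h1 := Nat.choose_mul_succ_eq (2 * n + 4) (n + 1)
    rw [show 2 * n + 4 + 1 - (n + 1) = n + 4 by omega,
      show 2 * n + 4 + 1 = 2 * n + 5 by ring] at h1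
    zify at h1 hT h
    generalize ((2 * n + 4).choose (n + 1) : ℤ) = T at *
    generalize ((2 * n + 5).choose (n + 1) : ℤ) = U at *
    generalize (n : ℤ) = x at *
    have hx : 4 ≤ x := by linarith
    have h2 : 6 * x * (x + 4) * (x ^ 2 - 7) ≤ T * (x ^ 2 - 7) :=
      mul_le_mul_of_nonneg_right hT (by nlinarith)
    have h3 : x * (x + 4) * ((x + 1) * (x + 2)) ≤ x * (x + 4) * (6 * (x ^ 2 - 7)) :=
      mul_le_mul_of_nonneg_left (by nlinarith) (by nlinarith)
    have h4 : 0 < x + 4 := by linarith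
    refine le_of_mul_le_mul_right ?_ h4
    nlinarith

lemma aux_step (n m : ℕ) (hn : 3 ≤ n) :
    3 * ((2 * n + 5 + 2 * m).choose (n + 1) : ℤ) ≤
      ((n + 2 + m).choose (n + 1) : ℤ) *
        (((2 * n + 4 + m).choose (n + 1) : ℤ) - (n ^ 2 + n)) := by
  induction m with
  | zero =>
    have := aux_base n hn
    have h : (n + 2).choose (n + 1) = n + 2 := Nat.choose_succ_self_right (n + 1)
    simp only [mul_zero, add_zero, h]
    push_cast
    exact this
  | succ m ih =>
    have hB := Nat.choose_mul_succ_eq (n + 2 + m) (n + 1)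
    rw [show n + 2 + m + 1 - (n + 1) = m + 2 by omega] at hB
    have hP := Nat.choose_mul_succ_eq (2 * n + 5 + 2 * m) (n + 1)
    rw [show 2 * n + 5 + 2 * m + 1 - (n + 1) = 2 * m + n + 5 by omega] at hP
    have hQ := Nat.choose_mul_succ_eq (2 * n + 5 + 2 * m + 1) (n + 1)
    rw [show 2 * n + 5 + 2 * m + 1 + 1 - (n + 1) = 2 * m + n + 6 by omega] at hQ
    have hE : (2 * n + 4 + m).choose (n + 1) ≤ (2 * n + 4 + (m + 1)).choose (n + 1) :=
      Nat.choose_le_choose _ (by omega)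
    rw [show 2 * n + 5 + 2 * (m + 1) = 2 * n + 5 + 2 * m + 1 + 1 by ring,
      show n + 2 + (m + 1) = n + 2 + m + 1 by ring]
    have hB0 : (0 : ℤ) ≤ ((n + 2 + m + 1).choose (n + 1) : ℤ) := by positivity
    have hP0 : (0 : ℤ) ≤ ((2 * n + 5 + 2 * m).choose (n + 1) : ℤ) := by positivity
    zify at hB hP hQ hE
    generalize ((2 * n + 4 + m).choose (n + 1) : ℤ) = E at *
    generalize ((2 * n + 4 + (m + 1)).choose (n + 1) : ℤ) = E' at *
    generalize ((n + 2 + m).choose (n + 1) : ℤ) = B at *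
    generalize ((n + 2 + m + 1).choose (n + 1) : ℤ) = B' at *
    generalize ((2 * n + 5 + 2 * m).choose (n + 1) : ℤ) = P at *
    generalize ((2 * n + 5 + 2 * m + 1).choose (n + 1) : ℤ) = Q at *
    generalize ((2 * n + 5 + 2 * m + 1 + 1).choose (n + 1) : ℤ) = R at *
    have hx : (0 : ℤ) ≤ n := by positivity
    have hy : (0 : ℤ) ≤ m := by positivity
    generalize (n : ℤ) = x at *
    generalize (m : ℤ) = y at *
    have k1 : R * (y + 2) ≤ P * (x + 3 + y) := by
      have hpos : 0 < (2 * y + x + 5) * (2 * y + x + 6) := by positivity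
      refine le_of_mul_le_mul_right ?_ hpos
      have e1 : R * (y + 2) * ((2 * y + x + 5) * (2 * y + x + 6)) =
          P * ((2 * x + 6 + 2 * y) * (2 * x + 7 + 2 * y) * (y + 2)) := by
        linear_combination (-(y + 2) * (2 * y + x + 5)) * hQ - (y + 2) * (2 * x + 7 + 2 * y) * hP
      rw [e1, mul_assoc P]
      refine mul_le_mul_of_nonneg_left ?_ hP0
      have : 0 ≤ (x + 3 + y) * ((x + 1) * (x + 2)) := by positivity
      nlinarith
    have k2 := mul_le_mul_of_nonneg_right ih (show 0 ≤ x + 3 + y by positivity)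
    have k3 : B * (E - (x ^ 2 + x)) * (x + 3 + y) = B' * (E - (x ^ 2 + x)) * (y + 2) := by
      linear_combination (E - (x ^ 2 + x)) * hB
    have k4 : 3 * R ≤ B' * (E - (x ^ 2 + x)) := by
      refine le_of_mul_le_mul_right ?_ (show 0 < y + 2 by positivity)
      linarith
    exact k4.trans (mul_le_mul_of_nonneg_left (by linarith) hB0)

/-- For all integers `n ≥ 3` and `d ≥ n + 3` one has, in the integers,
`C(d+n+1, n+1) − (n+2)² ≥ 3 · (⌊(C(2d−1, n+1) − (n+2)·C(d, n+1) − 1) / C(d−1, n+1)⌋ + 1)`,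
where `C` is the binomial coefficient and `⌊·/·⌋` is floor division
(`Int.fdiv`). -/
theorem stmt6 (n d : ℕ) (hn : 3 ≤ n) (hd : n + 3 ≤ d) :
    ((d + n + 1).choose (n + 1) : ℤ) - (n + 2) ^ 2 ≥
      3 * (Int.fdiv (((2 * d - 1).choose (n + 1) : ℤ) -
          (n + 2) * (d.choose (n + 1)) - 1) ((d - 1).choose (n + 1)) + 1) := by
  obtain ⟨m, rfl⟩ := Nat.exists_eq_add_of_le hd
  have hs := aux_step n m hn
  have hmono : (n + 2 + m).choose (n + 1) ≤ (n + 3 + m).choose (n + 1) :=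
    Nat.choose_le_choose _ (by omega)
  have hpos : 0 < (n + 2 + m).choose (n + 1) := Nat.choose_pos (by omega)
  rw [show n + 3 + m + n + 1 = 2 * n + 4 + m by ring,
    show 2 * (n + 3 + m) - 1 = 2 * n + 5 + 2 * m by omega,
    show n + 3 + m - 1 = n + 2 + m by omega]
  zify at hmono hpos
  rw [Int.fdiv_eq_ediv_of_nonneg _ hpos.le]
  generalize ((2 * n + 4 + m).choose (n + 1) : ℤ) = E at *
  generalize ((n + 2 + m).choose (n + 1) : ℤ) = B at *
  generalize ((n + 3 + m).choose (n + 1) : ℤ) = D at *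
  generalize ((2 * n + 5 + 2 * m).choose (n + 1) : ℤ) = P at *
  have hx : (0 : ℤ) ≤ n := by positivity
  generalize (n : ℤ) = x at *
  have hq := Int.ediv_mul_le (P - (x + 2) * D - 1) hpos.ne'
  generalize (P - (x + 2) * D - 1) / B = q at *
  by_contra hcon
  have hc : E - (x + 2) ^ 2 + 1 ≤ 3 * (q + 1) := by
    have := not_le.mp hcon
    linarith
  have h5 : (E - (x + 2) ^ 2 - 2) * B ≤ 3 * q * B :=
    mul_le_mul_of_nonneg_right (by linarith) hpos.le
  have h6 : (x + 2) * B ≤ (x + 2) * D := mul_le_mul_of_nonneg_left hmono (by linarith)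
  nlinarith
end

section
/- For all integers n ≥ 3 and d ≥ n+3 one has, in the rational numbers, C(d+n+1, n+1) − (n+2)² ≥ 3·(C(2d−1, n+1) − (n+2)·C(d, n+1)) / C(d−1, n+1) + 6, where C(a,b) denotes the binomial coefficient. -/
lemma aux_ratio (k m : ℕ) (hm : k ≤ m) :
    ((2 * (m + 1) + 1).choose k : ℚ) / ((m + 1).choose k) ≤
      ((2 * m + 1).choose k : ℚ) / (m.choose k) := by
  obtain ⟨j, rfl⟩ := Nat.exists_eq_add_of_le hm
  have e1 := Nat.choose_mul_succ_eq (k + j) k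
  have e2 := Nat.choose_mul_succ_eq (2 * (k + j) + 1) k
  have e3 := Nat.choose_mul_succ_eq (2 * (k + j) + 1 + 1) k
  rw [show k + j + 1 - k = j + 1 by omega] at e1
  rw [show 2 * (k + j) + 1 + 1 - k = k + 2 * j + 2 by omega] at e2
  rw [show 2 * (k + j) + 1 + 1 + 1 - k = k + 2 * j + 3 by omega] at e3
  rw [show 2 * (k + j + 1) + 1 = 2 * (k + j) + 1 + 1 + 1 by ring]
  have p1 : (0 : ℚ) < ((k + j).choose k) := by
    exact_mod_cast Nat.choose_pos (by omega)
  have p2 : (0 : ℚ) < ((k + j + 1).choose k) := by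
    exact_mod_cast Nat.choose_pos (by omega)
  have q1 : (((k + j).choose k : ℕ) : ℚ) * (k + j + 1) = ((k + j + 1).choose k) * (j + 1) := by
    exact_mod_cast e1
  have q2 : (((2 * (k + j) + 1).choose k : ℕ) : ℚ) * (2 * (k + j) + 1 + 1) =
      ((2 * (k + j) + 1 + 1).choose k) * (k + 2 * j + 2) := by
    exact_mod_cast e2
  have q3 : (((2 * (k + j) + 1 + 1).choose k : ℕ) : ℚ) * (2 * (k + j) + 1 + 1 + 1) =
      ((2 * (k + j) + 1 + 1 + 1).choose k) * (k + 2 * j + 3) := by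
    exact_mod_cast e3
  have p0 : (0 : ℚ) ≤ ((2 * (k + j) + 1).choose k) := by positivity
  generalize (((k + j).choose k : ℕ) : ℚ) = a at *
  generalize (((k + j + 1).choose k : ℕ) : ℚ) = b at *
  generalize (((2 * (k + j) + 1).choose k : ℕ) : ℚ) = x at *
  generalize (((2 * (k + j) + 1 + 1).choose k : ℕ) : ℚ) = y at *
  generalize (((2 * (k + j) + 1 + 1 + 1).choose k : ℕ) : ℚ) = z at *
  have hb : b = a * (k + j + 1) / (j + 1) := by field_simp; linarith
  have hy : y = x * (2 * (k + j) + 1 + 1) / (k + 2 * j + 2) := by field_simp; linarith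
  have hz : z = y * (2 * (k + j) + 1 + 1 + 1) / (k + 2 * j + 3) := by field_simp; linarith
  have key : z / b = (x / a) *
      ((2 * (2 * (k + j) + 3) * (j + 1)) / ((k + 2 * j + 2) * (k + 2 * j + 3))) := by
    rw [hz, hy, hb]; field_simp; ring
  rw [key]
  apply mul_le_of_le_one_right (by positivity)
  rw [div_le_one (by positivity)]
  have hk : (0 : ℚ) ≤ k := by positivity
  have hj : (0 : ℚ) ≤ j := by positivity
  nlinarith [mul_nonneg hk hj, mul_nonneg hk hk]

lemma aux_big (k : ℕ) (hk : 5 ≤ k) : 10 * (k + 1) ^ 2 ≤ (2 * k + 2).choose k := by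
  induction k, hk using Nat.le_induction with
  | base => decide
  | succ k hk ih =>
    have h1 : (2 * (k + 1) + 2).choose (k + 1) =
        (2 * k + 3).choose k + (2 * k + 3).choose (k + 1) := Nat.choose_succ_succ _ _
    have h2 : (2 * k + 3).choose (k + 1) =
        (2 * k + 2).choose k + (2 * k + 2).choose (k + 1) := Nat.choose_succ_succ _ _
    have h3 : (2 * k + 2).choose k ≤ (2 * k + 3).choose k := Nat.choose_le_choose _ (by omega)
    have h4 : (2 * k + 2).choose k ≤ (2 * k + 2).choose (k + 1) :=
      Nat.choose_le_succ_of_lt_half_left (by omega)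
    nlinarith

/-- The statement without the helpful negative term, by induction from a base case. -/
lemma aux_step_s7 (k m₀ : ℕ) (h0 : k ≤ m₀)
    (hb : 3 * (((2 * m₀ + 1).choose k : ℚ) / (m₀.choose k)) + 6 + (k + 1) ^ 2 ≤
      ((m₀ + 1 + k).choose k : ℚ)) (m : ℕ) (hm : m₀ ≤ m) :
    3 * (((2 * m + 1).choose k : ℚ) / (m.choose k)) + 6 + (k + 1) ^ 2 ≤
      ((m + 1 + k).choose k : ℚ) := by
  induction m, hm using Nat.le_induction with
  | base => exact hb
  | succ m hm ih =>
    have h1 := aux_ratio k m (by omega)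
    have h2 : ((m + 1 + k).choose k : ℚ) ≤ ((m + 1 + 1 + k).choose k : ℚ) := by
      exact_mod_cast Nat.choose_le_choose _ (by omega)
    linarith

lemma aux_base_s7 (k : ℕ) (hk : 5 ≤ k) :
    3 * (((2 * (k + 1) + 1).choose k : ℚ) / ((k + 1).choose k)) + 6 + (k + 1) ^ 2 ≤
      ((k + 1 + 1 + k).choose k : ℚ) := by
  have e := Nat.choose_mul_succ_eq (2 * k + 2) k
  rw [show 2 * k + 2 + 1 - k = k + 3 by omega] at e
  rw [Nat.choose_succ_self_right, show 2 * (k + 1) + 1 = 2 * k + 2 + 1 by ring,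
    show k + 1 + 1 + k = 2 * k + 2 by ring]
  have b : (10 : ℚ) * (k + 1) ^ 2 ≤ ((2 * k + 2).choose k : ℚ) := by exact_mod_cast aux_big k hk
  have q : ((2 * k + 2).choose k : ℚ) * (2 * k + 2 + 1) = ((2 * k + 2 + 1).choose k) * (k + 3) := by
    exact_mod_cast e
  generalize (((2 * k + 2).choose k : ℕ) : ℚ) = x at *
  generalize (((2 * k + 2 + 1).choose k : ℕ) : ℚ) = y at *
  have hy : y = x * (2 * k + 2 + 1) / (k + 3) := by field_simp; linarith
  obtain ⟨t, rfl⟩ := Nat.exists_eq_add_of_le hk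
  push_cast at *
  have ht : (0 : ℚ) ≤ t := by positivity
  have hr : 3 * (y / (5 + t + 1)) ≤ x * (39 / 48) := by
    have : 3 * (y / (5 + t + 1)) = x * (3 * (2 * t + 13) / ((t + 6) * (t + 8))) := by
      rw [hy]; field_simp; ring
    rw [this]
    apply mul_le_mul_of_nonneg_left _ (le_trans (by positivity) b)
    rw [div_le_div_iff₀ (by positivity) (by norm_num)]
    nlinarith [mul_nonneg ht ht]
  nlinarith [mul_nonneg ht ht]

/-- For all integers `n ≥ 3` and `d ≥ n + 3` one has, in the rationals,
`C(d+n+1, n+1) − (n+2)² ≥ 3 · (C(2d−1, n+1) − (n+2)·C(d, n+1)) / C(d−1, n+1) + 6`,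
where `C` is the binomial coefficient. -/
theorem stmt7 (n d : ℕ) (hn : 3 ≤ n) (hd : n + 3 ≤ d) :
    ((d + n + 1).choose (n + 1) : ℚ) - (n + 2) ^ 2 ≥
      3 * (((2 * d - 1).choose (n + 1) : ℚ) - (n + 2) * (d.choose (n + 1))) /
        ((d - 1).choose (n + 1)) + 6 := by
  by_cases hs : n = 3 ∧ d = 6
  · obtain ⟨rfl, rfl⟩ := hs
    norm_num [Nat.choose]
  obtain ⟨m, rfl⟩ : ∃ m, d = m + 1 := ⟨d - 1, by omega⟩
  have main : 3 * (((2 * m + 1).choose (n + 1) : ℚ) / (m.choose (n + 1))) + 6 +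
      (((n + 1 : ℕ) : ℚ) + 1) ^ 2 ≤ ((m + 1 + (n + 1)).choose (n + 1) : ℚ) := by
    by_cases h3 : n = 3
    · subst h3
      refine aux_step_s7 4 6 (by norm_num) ?_ m (by omega)
      norm_num [Nat.choose]
    · exact aux_step_s7 (n + 1) (n + 1 + 1) (by omega) (aux_base_s7 (n + 1) (by omega)) m (by omega)
  rw [show 2 * (m + 1) - 1 = 2 * m + 1 by omega, show m + 1 - 1 = m by omega,
    show m + 1 + n + 1 = m + 1 + (n + 1) by ring, mul_div_assoc, sub_div]
  have hp : (0 : ℚ) ≤ (n + 2) * ((m + 1).choose (n + 1)) / (m.choose (n + 1)) := by positivity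
  push_cast at main
  nlinarith
end

section
/- For every integer n ≥ 3 one has, in the rational numbers, C(2n+4, n+1) − (n+2)² ≥ 3·(C(2n+5, n+1) − (n+2)·C(n+3, n+1)) / (n+2) + 6, where C(a,b) denotes the binomial coefficient. -/
/-- For every integer `n ≥ 3` one has, in the rationals,
`C(2n+4, n+1) − (n+2)² ≥ 3·(C(2n+5, n+1) − (n+2)·C(n+3, n+1)) / (n+2) + 6`,
where `C` is the binomial coefficient. -/
theorem stmt9 (n : ℕ) (hn : 3 ≤ n) :
    ((2 * n + 4).choose (n + 1) : ℚ) - (n + 2) ^ 2 ≥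
      3 * (((2 * n + 5).choose (n + 1) : ℚ) -
        (n + 2) * ((n + 3).choose (n + 1))) / (n + 2) + 6 := by
  have h1 : ((2 * n + 4).choose (n + 1) : ℚ) * (2 * n + 5)
      = ((2 * n + 5).choose (n + 1) : ℚ) * (n + 4) := by
    have h := Nat.choose_mul_succ_eq (2 * n + 4) (n + 1)
    have e : 2 * n + 4 + 1 - (n + 1) = n + 4 := by omega
    rw [e] at h
    have h' := congrArg (Nat.cast : ℕ → ℚ) h
    push_cast at h'
    linarith
  have h2 : ((n + 3).choose (n + 1) : ℚ) = (n + 3) * (n + 2) / 2 := by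
    have e : (n + 3).choose (n + 1) = (n + 3).choose 2 :=
      Nat.choose_symm_of_eq_add (by omega)
    rw [e, Nat.cast_choose_two]
    push_cast
    ring
  have hn' : (3 : ℚ) ≤ n := by exact_mod_cast hn
  have hA : (0 : ℚ) ≤ ((2 * n + 4).choose (n + 1) : ℚ) := by positivity
  rw [h2]
  generalize ((2 * n + 4).choose (n + 1) : ℚ) = A at *
  generalize ((2 * n + 5).choose (n + 1) : ℚ) = B at *
  generalize (n : ℚ) = x at *
  have hB : B = A * (2 * x + 5) / (x + 4) := by
    rw [eq_div_iff (by linarith)]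
    exact h1.symm
  have h4 : x + 4 ≠ 0 := by linarith
  have h5 : x + 2 ≠ 0 := by linarith
  have key : A - (x + 2) ^ 2 - (3 * (B - (x + 2) * ((x + 3) * (x + 2) / 2)) / (x + 2) + 6)
      = A * (x ^ 2 - 7) / ((x + 4) * (x + 2)) + (x ^ 2 + 7 * x - 2) / 2 := by
    rw [hB]
    field_simp
    ring
  have p1 : 0 ≤ A * (x ^ 2 - 7) / ((x + 4) * (x + 2)) := by
    apply div_nonneg
    · exact mul_nonneg hA (by nlinarith)
    · nlinarith
  have p2 : 0 ≤ (x ^ 2 + 7 * x - 2) / 2 := by nlinarith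
  linarith
end

section
/- Fix an integer n ≥ 3. Then for every integer d ≥ n+3 one has, in the rational numbers, (C(2d−1, n+1) − (n+2)·C(d, n+1)) / C(d−1, n+1) ≥ (C(2d+1, n+1) − (n+2)·C(d+1, n+1)) / C(d, n+1), where C(a,b) denotes the binomial coefficient; that is, the function r(d) = (C(2d−1, n+1) − (n+2)·C(d, n+1))/C(d−1, n+1) is decreasing in d for d ≥ n+3. -/
theorem aux_up (a k : ℕ) (h : k ≤ a + 1) :
    (((a + 1).choose k : ℕ) : ℚ) * ((a : ℚ) + 1 - k) = (a.choose k : ℚ) * (a + 1) := by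
  have h1 := Nat.choose_mul_succ_eq a k
  have h2 : (((a.choose k * (a + 1) : ℕ)) : ℚ) = (((a + 1).choose k * (a + 1 - k) : ℕ) : ℚ) := by
    rw [h1]
  rw [Nat.cast_mul, Nat.cast_mul, Nat.cast_sub h] at h2
  push_cast at h2
  exact h2.symm

theorem aux_right (a k : ℕ) (h : k ≤ a) :
    ((a.choose (k + 1) : ℕ) : ℚ) * ((k : ℚ) + 1) = (a.choose k : ℚ) * (a - k) := by
  have h1 := Nat.choose_succ_right_eq a k
  have h2 : (((a.choose (k + 1) * (k + 1) : ℕ)) : ℚ) = ((a.choose k * (a - k) : ℕ) : ℚ) := by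
    rw [h1]
  rw [Nat.cast_mul, Nat.cast_mul, Nat.cast_sub h] at h2
  push_cast at h2
  exact h2

/-- Fix an integer `n ≥ 3`.  For every integer `d ≥ n + 3` one has, in the
rationals,
`(C(2d−1, n+1) − (n+2)·C(d, n+1)) / C(d−1, n+1) ≥ (C(2d+1, n+1) − (n+2)·C(d+1, n+1)) / C(d, n+1)`,
i.e. the ratio `r(d) = h^{n−1,1}/h^{n,0}` of Hodge numbers is decreasing in
`d` for `d ≥ n + 3`. -/
theorem stmt11 (n : ℕ) (hn : 3 ≤ n) (d : ℕ) (hd : n + 3 ≤ d) :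
    (((2 * d - 1).choose (n + 1) : ℚ) - (n + 2) * (d.choose (n + 1))) /
        ((d - 1).choose (n + 1)) ≥
      (((2 * d + 1).choose (n + 1) : ℚ) - (n + 2) * ((d + 1).choose (n + 1))) /
        (d.choose (n + 1)) := by
  obtain ⟨m, rfl⟩ : ∃ m, n = m + 1 := ⟨n - 1, by omega⟩
  obtain ⟨e, rfl⟩ : ∃ e, d = m + e + 4 := ⟨d - (m + 4), by omega⟩
  have e1 : m + e + 4 - 1 = m + e + 3 := by omega
  have e2 : 2 * (m + e + 4) - 1 = 2 * m + 2 * e + 7 := by omega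
  have e3 : 2 * (m + e + 4) + 1 = 2 * m + 2 * e + 7 + 1 + 1 := by omega
  rw [e1, e2, e3]
  have hXY : (((m + e + 3).choose m : ℕ) : ℚ) ≤ ((2 * m + 2 * e + 7).choose m : ℕ) := by
    exact_mod_cast Nat.choose_le_choose m (by omega)
  have hY : (0 : ℚ) < ((m + e + 3).choose m : ℕ) := by
    exact_mod_cast Nat.choose_pos (by omega)
  have p1 := aux_right (2 * m + 2 * e + 7) m (by omega)
  have p2 := aux_right (2 * m + 2 * e + 7) (m + 1) (by omega)
  have q1 := aux_right (m + e + 3) m (by omega)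
  have q2 := aux_right (m + e + 3) (m + 1) (by omega)
  have u1 := aux_up (m + e + 3) (m + 1 + 1) (by omega)
  have u2 := aux_up (m + e + 4) (m + 1 + 1) (by omega)
  have v1 := aux_up (2 * m + 2 * e + 7) (m + 1 + 1) (by omega)
  have v2 := aux_up (2 * m + 2 * e + 7 + 1) (m + 1 + 1) (by omega)
  rw [show m + e + 3 + 1 = m + e + 4 from rfl] at u1
  generalize ((2 * m + 2 * e + 7 + 1 + 1).choose (m + 1 + 1)) = P2 at *
  generalize ((2 * m + 2 * e + 7 + 1).choose (m + 1 + 1)) = P1 at *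
  generalize ((2 * m + 2 * e + 7).choose (m + 1 + 1)) = P0 at *
  generalize ((2 * m + 2 * e + 7).choose (m + 1)) = X1 at *
  generalize ((2 * m + 2 * e + 7).choose m) = X at *
  generalize ((m + e + 4 + 1).choose (m + 1 + 1)) = Q2 at *
  generalize ((m + e + 4).choose (m + 1 + 1)) = Q1 at *
  generalize ((m + e + 3).choose (m + 1 + 1)) = Q0 at *
  generalize ((m + e + 3).choose (m + 1)) = Y1 at *
  generalize ((m + e + 3).choose m) = Y at *
  push_cast at *
  have hm : (0 : ℚ) ≤ m := Nat.cast_nonneg m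
  have he : (0 : ℚ) ≤ e := Nat.cast_nonneg e
  generalize (m : ℚ) = m at *
  generalize (e : ℚ) = e at *
  generalize (X : ℚ) = X at *
  generalize (Y : ℚ) = Y at *
  have fX1 : (X1 : ℚ) = X * (m + 2 * e + 7) / (m + 1) := by
    rw [eq_div_iff (by positivity)]; linarith
  have fP0 : (P0 : ℚ) = X1 * (m + 2 * e + 6) / (m + 2) := by
    rw [eq_div_iff (by positivity)]; linarith
  have fY1 : (Y1 : ℚ) = Y * (e + 3) / (m + 1) := by
    rw [eq_div_iff (by positivity)]; linarith
  have fQ0 : (Q0 : ℚ) = Y1 * (e + 2) / (m + 2) := by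
    rw [eq_div_iff (by positivity)]; linarith
  have fQ1 : (Q1 : ℚ) = Q0 * (m + e + 4) / (e + 2) := by
    rw [eq_div_iff (by positivity)]; linarith
  have fQ2 : (Q2 : ℚ) = Q1 * (m + e + 5) / (e + 3) := by
    rw [eq_div_iff (by positivity)]; linarith
  have fP1 : (P1 : ℚ) = P0 * (2 * m + 2 * e + 8) / (m + 2 * e + 6) := by
    rw [eq_div_iff (by positivity)]; linarith
  have fP2 : (P2 : ℚ) = P1 * (2 * m + 2 * e + 9) / (m + 2 * e + 7) := by
    rw [eq_div_iff (by positivity)]; linarith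
  rw [fP2, fP1, fQ2, fQ1, fP0, fQ0, fX1, fY1, ge_iff_le, ← sub_nonneg]
  have key : (0 : ℚ) ≤ (m + 2) * (m + 3) * (X - Y) / (Y * (e + 2) * (e + 3)) := by
    have : 0 ≤ X - Y := by linarith
    positivity
  refine key.trans (le_of_eq ?_)
  have hY' := hY.ne'
  field_simp
  ring
end

section
/- For all integers n ≥ 1 and all integers d, the following identity holds in the integers: d·( ∏_{i=1}^{n+1}(2d−i) − (n+2)·∏_{i=0}^{n}(d−i) ) − (d−n−1)·( ∏_{i=−1}^{n−1}(2d−i) − (n+2)·∏_{i=−1}^{n−1}(d−i) ) = d·(n²+3n+2)·( ∏_{i=1}^{n−1}(2d−i) − ∏_{i=1}^{n−1}(d−i) ). -/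
theorem prod_Icc_right_aux (f : ℤ → ℤ) (a b : ℤ) (h : a ≤ b) :
    ∏ i ∈ Finset.Icc a b, f i = f b * ∏ i ∈ Finset.Icc a (b - 1), f i := by
  have : Finset.Icc a b = insert b (Finset.Icc a (b - 1)) := by
    ext x
    simp only [Finset.mem_Icc, Finset.mem_insert]
    omega
  rw [this, Finset.prod_insert (by simp)]

theorem prod_Icc_left_aux (f : ℤ → ℤ) (a b : ℤ) (h : a ≤ b) :
    ∏ i ∈ Finset.Icc a b, f i = f a * ∏ i ∈ Finset.Icc (a + 1) b, f i := by
  have : Finset.Icc a b = insert a (Finset.Icc (a + 1) b) := by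
    ext x
    simp only [Finset.mem_Icc, Finset.mem_insert]
    omega
  rw [this, Finset.prod_insert (by simp)]

open Finset in
/-- For all integers `n ≥ 1` and all integers `d`:
`d·(∏_{i=1}^{n+1} (2d−i) − (n+2)·∏_{i=0}^{n} (d−i)) − (d−n−1)·(∏_{i=−1}^{n−1} (2d−i) − (n+2)·∏_{i=−1}^{n−1} (d−i)) = d·(n²+3n+2)·(∏_{i=1}^{n−1} (2d−i) − ∏_{i=1}^{n−1} (d−i))`. -/
theorem stmt12 (n : ℕ) (hn : 1 ≤ n) (d : ℤ) :
    d * ((∏ i ∈ Icc (1 : ℤ) (n + 1), (2 * d - i)) -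
        (n + 2) * ∏ i ∈ Icc (0 : ℤ) (n : ℤ), (d - i)) -
      (d - n - 1) * ((∏ i ∈ Icc (-1 : ℤ) ((n : ℤ) - 1), (2 * d - i)) -
        (n + 2) * ∏ i ∈ Icc (-1 : ℤ) ((n : ℤ) - 1), (d - i)) =
    d * ((n : ℤ) ^ 2 + 3 * n + 2) *
      ((∏ i ∈ Icc (1 : ℤ) ((n : ℤ) - 1), (2 * d - i)) -
        ∏ i ∈ Icc (1 : ℤ) ((n : ℤ) - 1), (d - i)) := by
  have hn' : (1 : ℤ) ≤ n := by exact_mod_cast hn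
  have e1 : ∀ f : ℤ → ℤ, ∏ i ∈ Icc (1 : ℤ) (n + 1), f i =
      f (n + 1) * (f n * ∏ i ∈ Icc (1 : ℤ) ((n : ℤ) - 1), f i) := by
    intro f
    rw [prod_Icc_right_aux f 1 (n + 1) (by omega), add_sub_cancel_right,
      prod_Icc_right_aux f 1 n (by omega)]
  have e2 : ∀ f : ℤ → ℤ, ∏ i ∈ Icc (0 : ℤ) (n : ℤ), f i =
      f n * (f 0 * ∏ i ∈ Icc (1 : ℤ) ((n : ℤ) - 1), f i) := by
    intro f
    rw [prod_Icc_right_aux f 0 n (by omega), prod_Icc_left_aux f 0 _ (by omega), zero_add]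
  have e3 : ∀ f : ℤ → ℤ, ∏ i ∈ Icc (-1 : ℤ) ((n : ℤ) - 1), f i =
      f (-1) * (f 0 * ∏ i ∈ Icc (1 : ℤ) ((n : ℤ) - 1), f i) := by
    intro f
    rw [prod_Icc_left_aux f (-1) _ (by omega), neg_add_cancel,
      prod_Icc_left_aux f 0 _ (by omega), zero_add]
  rw [e1, e2, e3, e3]
  ring
end
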